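/- Let Assumption W* hold, let Assumption B̲_{{α_n}} hold for a sequence α_n ↑ 1, and let Assumption LEC_{{α_n}} be satisfied for this sequence. Then there exists a deterministic policy φ such that the average-cost optimality equation (ACOE) holds with the function u(x) := lim_{n→∞} u_{α_n}(x): for all x ∈ X, w* + u(x) = c(x,φ(x)) + ∫_X u(y) q(dy|x,φ(x)) = min_{a∈A} [ c(x,a) + ∫_X u(y) q(dy|x,a) ]. -/

import Mathlib

open MeasureTheory ProbabilityTheory Filter Topology Set
open scoped ENNReal NNReal

noncomputable section

/-- The nonnegative part of an extended real, as an element of `ℝ≥0∞`. -/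
def eToENN (x : EReal) : ℝ≥0∞ := if x = ⊤ then ⊤ else ENNReal.ofReal x.toReal

/-- Extended integral of an `EReal`-valued function: positive part minus negative part. -/
def eInt {Y : Type*} [MeasurableSpace Y] (μ : Measure Y) (f : Y → EReal) : EReal :=
  ((∫⁻ y, eToENN (f y) ∂μ : ℝ≥0∞) : EReal) - ((∫⁻ y, eToENN (-(f y)) ∂μ : ℝ≥0∞) : EReal)

/-- Extended sum of an `EReal`-valued series: positive part minus negative part. -/
def eSum (f : ℕ → EReal) : EReal :=
  ((∑' t, eToENN (f t) : ℝ≥0∞) : EReal) - ((∑' t, eToENN (-(f t)) : ℝ≥0∞) : EReal)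

/-- Histories of length `t`: `(X × A) ^ t × X`. -/
abbrev Hist (X A : Type*) (t : ℕ) := (Fin t → X × A) × X

/-- A (randomized, history-dependent) policy: a regular transition probability from
histories to actions, at every time epoch. -/
structure Policy (X A : Type*) [MeasurableSpace X] [MeasurableSpace A] where
  π : ∀ t : ℕ, Kernel (Hist X A t) A
  markov : ∀ t, IsMarkovKernel (π t)

/-- A Markov decision process with state space `X`, action space `A`, one-step cost `c`
(measurable and bounded below, with values in `(-∞, +∞]`) and transition probability `q`. -/
structure MDP (X A : Type*) [MeasurableSpace X] [MeasurableSpace A] where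
  c : X → A → EReal
  q : Kernel (X × A) X
  markov : IsMarkovKernel q
  c_meas : Measurable fun p : X × A => c p.1 p.2
  c_ne_bot : ∃ K : ℝ, ∀ x a, (K : EReal) ≤ c x a

variable {X A : Type*} [MeasurableSpace X] [MeasurableSpace A]

/-- The deterministic policy given by a measurable map `φ : X → A` applied to the current state. -/
def detPolicy (φ : X → A) (hφ : Measurable φ) : Policy X A :=
  ⟨fun t => Kernel.deterministic (fun h : Hist X A t => φ h.2) (hφ.comp measurable_snd),
   fun _ => by infer_instance⟩

/-- The distribution `P_x^π` of the history `h_t`, constructed recursively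
(Ionescu-Tulcea finite-dimensional marginals). -/
def histMeas (M : MDP X A) (p : Policy X A) (x : X) : ∀ t : ℕ, Measure (Hist X A t)
  | 0 => Measure.dirac (Fin.elim0, x)
  | (t + 1) =>
      (histMeas M p x t).bind fun h =>
        ((p.π t) h).bind fun a =>
          (M.q (h.2, a)).map fun x' => (Fin.snoc h.1 (h.2, a), x')

/-- The joint distribution of the state-action pair `(x_t, a_t)` under `P_x^π`. -/
def saMeas (M : MDP X A) (p : Policy X A) (x : X) (t : ℕ) : Measure (X × A) :=
  (histMeas M p x t).bind fun h => ((p.π t) h).map fun a => (h.2, a)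

/-- `E_x^π c(x_t, a_t)`. -/
def expCost (M : MDP X A) (p : Policy X A) (x : X) (t : ℕ) : EReal :=
  eInt (saMeas M p x t) fun sa => M.c sa.1 sa.2

/-- The expected total discounted cost `v_α^π(x) = E_x^π ∑_t α^t c(x_t, a_t)`. -/
def vDisc (M : MDP X A) (α : ℝ) (p : Policy X A) (x : X) : EReal :=
  eSum fun t => ((α ^ t : ℝ) : EReal) * expCost M p x t

/-- The finite-horizon expected total (undiscounted) cost `v_{N,1}^π(x)`. -/
def vFin (M : MDP X A) (N : ℕ) (p : Policy X A) (x : X) : EReal :=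
  ∑ t ∈ Finset.range N, expCost M p x t

/-- The discounted value function `v_α(x) = inf_π v_α^π(x)`. -/
def vDiscOpt (M : MDP X A) (α : ℝ) (x : X) : EReal :=
  ⨅ p : Policy X A, vDisc M α p x

/-- The average cost per unit time `w^π(x)`. -/
def avgCost (M : MDP X A) (p : Policy X A) (x : X) : EReal :=
  Filter.limsup (fun N : ℕ => (((N : ℝ)⁻¹ : ℝ) : EReal) * vFin M N p x) atTop

/-- The optimal average cost `w(x) = inf_π w^π(x)`. -/
def avgOpt (M : MDP X A) (x : X) : EReal :=
  ⨅ p : Policy X A, avgCost M p x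

/-- `w* = inf_x w(x)`. -/
def wStar (M : MDP X A) : EReal := ⨅ x : X, avgOpt M x

/-- `m_α = inf_x v_α(x)`. -/
def mDisc (M : MDP X A) (α : ℝ) : EReal := ⨅ x : X, vDiscOpt M α x

/-- The discounted relative value function `u_α(x) = v_α(x) - m_α`. -/
def uDisc (M : MDP X A) (α : ℝ) (x : X) : EReal := vDiscOpt M α x - mDisc M α

/-- `w̄ = limsup_{α↑1} (1-α) m_α`. -/
def wBar (M : MDP X A) : EReal :=
  Filter.limsup (fun α : ℝ => ((1 - α : ℝ) : EReal) * mDisc M α) (𝓝[Set.Ico (0:ℝ) 1] 1)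

/-- `w̲ = liminf_{α↑1} (1-α) m_α`. -/
def wLow (M : MDP X A) : EReal :=
  Filter.liminf (fun α : ℝ => ((1 - α : ℝ) : EReal) * mDisc M α) (𝓝[Set.Ico (0:ℝ) 1] 1)

/-- `w̄_{{α_n}} = limsup_n (1-α_n) m_{α_n}`. -/
def wBarSeq (M : MDP X A) (a : ℕ → ℝ) : EReal :=
  Filter.limsup (fun n : ℕ => ((1 - a n : ℝ) : EReal) * mDisc M (a n)) atTop

/-- `w̲_{{α_n}} = liminf_n (1-α_n) m_{α_n}`. -/
def wLowSeq (M : MDP X A) (a : ℕ → ℝ) : EReal :=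
  Filter.liminf (fun n : ℕ => ((1 - a n : ℝ) : EReal) * mDisc M (a n)) atTop


section TopologicalAssumptions

variable {X A : Type*} [MetricSpace X] [TopologicalSpace.SeparableSpace X]
  [MeasurableSpace X] [BorelSpace X] [StandardBorelSpace X]
  [MetricSpace A] [TopologicalSpace.SeparableSpace A]
  [MeasurableSpace A] [BorelSpace A] [StandardBorelSpace A]

/-- Assumption W*(i): the cost `c` is `K`-inf-compact, i.e., for every nonempty compact
`K ⊆ X`, the restriction of `c` to `K × A` has compact sublevel sets. -/
def AssumptionWi (M : MDP X A) : Prop :=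
  ∀ K : Set X, K.Nonempty → IsCompact K →
    ∀ lam : ℝ, IsCompact {p : X × A | p.1 ∈ K ∧ M.c p.1 p.2 ≤ (lam : EReal)}

/-- Assumption W*(ii): the transition probability `q(·|x,a)` is weakly continuous in `(x,a)`. -/
def AssumptionWii (M : MDP X A) : Prop :=
  ∀ f : BoundedContinuousFunction X ℝ, Continuous fun p : X × A => ∫ y, f y ∂ (M.q p)

/-- Assumption S*(i): for each `x`, the function `a ↦ c(x,a)` has compact sublevel sets. -/
def AssumptionSi (M : MDP X A) : Prop :=
  ∀ x : X, ∀ lam : ℝ, IsCompact {a : A | M.c x a ≤ (lam : EReal)}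

/-- Assumption S*(ii): for each `x`, the transition probability `q(·|x,a)` is setwise
continuous in `a`. -/
def AssumptionSii (M : MDP X A) : Prop :=
  ∀ x : X, ∀ B : Set X, MeasurableSet B → Continuous fun a : A => M.q (x, a) B

end TopologicalAssumptions

section Statements

variable {X A : Type*} [MetricSpace X] [TopologicalSpace.SeparableSpace X]
  [MeasurableSpace X] [BorelSpace X] [StandardBorelSpace X]
  [MetricSpace A] [TopologicalSpace.SeparableSpace A]
  [MeasurableSpace A] [BorelSpace A] [StandardBorelSpace A]

/-- The pointwise limit `u(x) = lim_{n→∞} u_{α_n}(x)` (realized as a lower limit,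
which equals the limit whenever the latter exists). -/
def uPointwise (M : MDP X A) (a : ℕ → ℝ) (x : X) : EReal :=
  Filter.liminf (fun n : ℕ => uDisc M (a n) x) atTop

end Statements

section Selection

variable {S E : Type*} [MeasurableSpace S] [MetricSpace E]

/-- A compact-valued multifunction with nonempty values that hits every closed set measurably. -/
structure IsMeasurableCompactMultifunction (D : S → Set E) : Prop where
  isCompact : ∀ x, IsCompact (D x)
  nonempty : ∀ x, (D x).Nonempty
  measurableSet_hit : ∀ B : Set E, IsClosed B → MeasurableSet {x | (D x ∩ B).Nonempty}

theorem IsMeasurableCompactMultifunction.exists_inter_closedBall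
    {D : S → Set E} (hD : IsMeasurableCompactMultifunction D) {e : ℕ → E} (he : DenseRange e)
    {r : ℝ} (hr : 0 < r) :
    ∃ i : S → ℕ, Measurable i ∧
      IsMeasurableCompactMultifunction fun x => D x ∩ Metric.closedBall (e (i x)) r := by
  classical
  have hex : ∀ x, ∃ j, (D x ∩ Metric.closedBall (e j) r).Nonempty := by
    intro x
    obtain ⟨d, hd⟩ := hD.nonempty x
    obtain ⟨j, hj⟩ := he.exists_dist_lt d hr
    exact ⟨j, d, hd, hj.le⟩
  have hmeas : Measurable fun x => Nat.find (hex x) :=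
    measurable_find hex fun k => hD.measurableSet_hit _ Metric.isClosed_closedBall
  refine ⟨fun x => Nat.find (hex x), hmeas, fun x => (hD.isCompact x).inter_right
    Metric.isClosed_closedBall, fun x => Nat.find_spec (hex x), fun B hB => ?_⟩
  have : {x | (D x ∩ Metric.closedBall (e (Nat.find (hex x))) r ∩ B).Nonempty}
      = ⋃ j, {x | Nat.find (hex x) = j} ∩ {x | (D x ∩ (Metric.closedBall (e j) r ∩ B)).Nonempty} := by
    ext x
    simp [inter_assoc]
  rw [this]
  exact MeasurableSet.iUnion fun j => (hmeas (measurableSet_singleton j)).inter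
    (hD.measurableSet_hit _ (Metric.isClosed_closedBall.inter hB))

/-- A measurable compact-valued multifunction in a separable metric space has a measurable
selector. -/
theorem IsMeasurableCompactMultifunction.exists_measurable_selector
    [TopologicalSpace.SeparableSpace E] [MeasurableSpace E] [BorelSpace E]
    {D : S → Set E} (hD : IsMeasurableCompactMultifunction D) :
    ∃ φ : S → E, Measurable φ ∧ ∀ x, φ x ∈ D x := by
  rcases isEmpty_or_nonempty S with hS | ⟨⟨x₀⟩⟩
  · exact ⟨fun x => isEmptyElim x, measurable_of_empty _, fun x => isEmptyElim x⟩
  have : Nonempty E := (hD.nonempty x₀).to_type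
  obtain ⟨e, he⟩ := TopologicalSpace.exists_dense_seq E
  have hpos : ∀ n : ℕ, (0 : ℝ) < (1 / 2) ^ n := fun n => by positivity
  choose! i hi hstep using
    fun (D : S → Set E) (n : ℕ) (hD : IsMeasurableCompactMultifunction D) =>
      hD.exists_inter_closedBall he (hpos n)
  let Ds : ℕ → S → Set E := fun n => Nat.rec D
    (fun n C x => C x ∩ Metric.closedBall (e (i C n x)) ((1 / 2) ^ n)) n
  have hDs_succ : ∀ n x, Ds (n + 1) x
      = Ds n x ∩ Metric.closedBall (e (i (Ds n) n x)) ((1 / 2) ^ n) := fun n x => rfl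
  have hDs : ∀ n, IsMeasurableCompactMultifunction (Ds n) := by
    intro n
    induction n with
    | zero => exact hD
    | succ n ih => exact hstep (Ds n) n ih
  have hne : ∀ x, (⋂ n, Ds n x).Nonempty := fun x =>
    IsCompact.nonempty_iInter_of_sequence_nonempty_isCompact_isClosed (fun n => Ds n x)
      (fun n => by rw [hDs_succ]; exact inter_subset_left) (fun n => (hDs n).nonempty x)
      ((hDs 0).isCompact x) fun n => ((hDs n).isCompact x).isClosed
  choose φ hφ using hne
  have hφ' : ∀ x n, φ x ∈ Ds n x := fun x n => mem_iInter.1 (hφ x) n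
  refine ⟨φ, ?_, fun x => hφ' x 0⟩
  refine measurable_of_tendsto_metrizable (f := fun n x => e (i (Ds n) n x)) (fun n =>
    (measurable_from_nat (f := e)).comp (hi (Ds n) n (hDs n))) (tendsto_pi_nhds.2 fun x => ?_)
  rw [tendsto_iff_dist_tendsto_zero]
  refine squeeze_zero (fun _ => dist_nonneg) (fun n => ?_)
    (tendsto_pow_atTop_nhds_zero_of_lt_one (r := (1 / 2 : ℝ)) (by norm_num) (by norm_num))
  have := hφ' x (n + 1)
  rw [hDs_succ] at this
  rw [dist_comm]
  exact this.2

end Selection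

section WeakConvergence

variable {S P : Type*} [MeasurableSpace S] [TopologicalSpace S] [BorelSpace S]

/-- The integral of a nonnegative lower semicontinuous function is lower semicontinuous in a
parameter on which the measure depends weakly continuously. -/
theorem LowerSemicontinuous.lintegral_of_weakly_continuous [HasOuterApproxClosed S]
    [TopologicalSpace P] [FirstCountableTopology P] (q : P → Measure S)
    [∀ p, IsProbabilityMeasure (q p)]
    (hq : ∀ f : BoundedContinuousFunction S ℝ, Continuous fun p => ∫ y, f y ∂(q p))
    {w : S → ℝ≥0∞} (hw : LowerSemicontinuous w) :
    LowerSemicontinuous fun p => ∫⁻ y, w y ∂(q p) := by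
  have hopen : ∀ G : Set S, IsOpen G → ∀ p, q p G ≤ liminf (fun p' => q p' G) (𝓝 p) := by
    intro G hG p
    refine ProbabilityMeasure.le_liminf_measure_open_of_tendsto
      (μ := (⟨q p, inferInstance⟩ : ProbabilityMeasure S))
      (μs := fun p' => (⟨q p', inferInstance⟩ : ProbabilityMeasure S)) ?_ hG
    exact ProbabilityMeasure.tendsto_iff_forall_integral_tendsto.2 fun f => (hq f).tendsto p
  have htrunc : ∀ n : ℕ, LowerSemicontinuous fun p => ∫⁻ y, min (w y) n ∂(q p) := by
    intro n
    have hfin : ∀ y, min (w y) (n : ℝ≥0∞) ≠ ⊤ := fun y =>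
      ((min_le_right _ _).trans_lt (ENNReal.natCast_lt_top n)).ne
    have hmin : LowerSemicontinuous fun y => min (w y) (n : ℝ≥0∞) :=
      hw.inf lowerSemicontinuous_const
    have hcake : ∀ p, ∫⁻ y, min (w y) n ∂(q p)
        = ∫⁻ t in Ioi (0 : ℝ), q p {y | t < (min (w y) (n : ℝ≥0∞)).toReal} := by
      intro p
      rw [← lintegral_eq_lintegral_meas_lt (q p) (ae_of_all _ fun _ => ENNReal.toReal_nonneg)
        hmin.measurable.ennreal_toReal.aemeasurable]
      simp only [ENNReal.ofReal_toReal (hfin _)]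
    rw [lowerSemicontinuous_iff_le_liminf]
    intro p
    simp only [hcake]
    refine (setLIntegral_mono' measurableSet_Ioi fun t ht => hopen _ ?_ p).trans
      (lintegral_liminf_le fun p' => Antitone.measurable fun s t hst =>
        measure_mono fun y hy => lt_of_le_of_lt hst hy)
    have : {y | t < (min (w y) (n : ℝ≥0∞)).toReal}
        = (fun y => min (w y) (n : ℝ≥0∞)) ⁻¹' Ioi (ENNReal.ofReal t) := by
      ext y
      exact (ENNReal.ofReal_lt_iff_lt_toReal (le_of_lt ht) (hfin y)).symm
    rw [this]
    exact hmin.isOpen_preimage _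
  have hsup : (fun p => ∫⁻ y, w y ∂(q p)) = fun p => ⨆ n : ℕ, ∫⁻ y, min (w y) n ∂(q p) := by
    funext p
    rw [← lintegral_iSup (fun n => hw.measurable.min measurable_const)
      (fun m n hmn y => min_le_min le_rfl (by exact_mod_cast hmn))]
    refine lintegral_congr fun y => ?_
    change w y = ⨆ n : ℕ, w y ⊓ n
    rw [← inf_iSup_eq, ENNReal.iSup_natCast, inf_top_eq]
  rw [hsup]
  exact lowerSemicontinuous_iSup htrunc

end WeakConvergence

section InfCompact

variable {S E : Type*} [MetricSpace S] [MetricSpace E]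

/-- Sequences along which `g` stays bounded and the first coordinate converges have a convergent
subsequence of second coordinates. -/
def SeqInfCompact (g : S × E → ℝ≥0∞) : Prop :=
  ∀ (xs : ℕ → S) (x : S) (bs : ℕ → E) (l : ℝ≥0∞), Tendsto xs atTop (𝓝 x) → l < ⊤ →
    (∀ n, g (xs n, bs n) ≤ l) → ∃ b, ∃ ψ : ℕ → ℕ, StrictMono ψ ∧ Tendsto (bs ∘ ψ) atTop (𝓝 b)

theorem SeqInfCompact.mono {g h : S × E → ℝ≥0∞} (hg : SeqInfCompact g) (hgh : g ≤ h) :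
    SeqInfCompact h :=
  fun xs x bs l hx hl hb => hg xs x bs l hx hl fun n => (hgh _).trans (hb n)

theorem SeqInfCompact.exists_forall_le {g : S × E → ℝ≥0∞} (hg : SeqInfCompact g)
    {H : ℕ → S × E → ℝ≥0∞} (hH : ∀ m, LowerSemicontinuous (H m)) (hgH : g ≤ H 0)
    {xs : ℕ → S} {x : S} {bs : ℕ → E} {ls : ℕ → ℝ≥0∞} {l : ℝ≥0∞} {B : Set E} (hB : IsClosed B)
    (hx : Tendsto xs atTop (𝓝 x)) (hls : Tendsto ls atTop (𝓝 l)) (hl : l < ⊤)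
    (hbB : ∀ n, bs n ∈ B) (hle : ∀ m n, m ≤ n → H m (xs n, bs n) ≤ ls n) :
    ∃ b ∈ B, ∀ m, H m (x, b) ≤ l := by
  obtain ⟨l', hll', hl'⟩ := exists_between hl
  obtain ⟨N, hN⟩ := eventually_atTop.1 (hls.eventually_lt_const hll')
  obtain ⟨b, ψ, hψ, hb⟩ := hg (fun n => xs (n + N)) x (fun n => bs (n + N)) l'
    (hx.comp (tendsto_add_atTop_nat N)) hl'
    (fun n => (hgH _).trans ((hle 0 _ (Nat.zero_le _)).trans (hN _ (Nat.le_add_left _ _)).le))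
  have hψN : Tendsto (fun n => ψ n + N) atTop atTop :=
    (tendsto_add_atTop_nat N).comp hψ.tendsto_atTop
  refine ⟨b, hB.mem_of_tendsto hb (Eventually.of_forall fun n => hbB _), fun m => ?_⟩
  have hlim : Tendsto (fun n => (xs (ψ n + N), bs (ψ n + N))) atTop (𝓝 (x, b)) :=
    (hx.comp hψN).prodMk_nhds hb
  refine le_of_forall_lt fun t ht => ?_
  have h1 := hlim.eventually (hH m _ t ht)
  obtain ⟨t', htt', ht'⟩ := exists_between ht
  have h2 := hlim.eventually (hH m _ t' ht')
  refine htt'.trans_le (ge_of_tendsto (hls.comp hψN) ?_)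
  filter_upwards [h2, hψN.eventually_ge_atTop m] with n hn hmn
  exact hn.le.trans (hle m _ hmn)

variable {F : S × E → ℝ≥0∞} (hF : LowerSemicontinuous F) (hFc : SeqInfCompact F)
include hF hFc

theorem exists_le_of_biInf_le {B : Set E} (hB : IsClosed B) {xs : ℕ → S} {x : S}
    (hx : Tendsto xs atTop (𝓝 x)) {l : ℝ≥0∞} (hl : l < ⊤)
    (hle : ∀ n, ⨅ b ∈ B, F (xs n, b) ≤ l) : ∃ b ∈ B, F (x, b) ≤ l := by
  have hex : ∀ n : ℕ, ∃ b ∈ B, F (xs n, b) ≤ l + (n : ℝ≥0∞)⁻¹ := by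
    intro n
    have : ⨅ b ∈ B, F (xs n, b) < l + (n : ℝ≥0∞)⁻¹ :=
      (hle n).trans_lt (ENNReal.lt_add_right hl.ne (by simp))
    simp only [iInf_lt_iff] at this
    obtain ⟨b, hb, h⟩ := this
    exact ⟨b, hb, h.le⟩
  choose bs hbs hbl using hex
  have hls : Tendsto (fun n : ℕ => l + (n : ℝ≥0∞)⁻¹) atTop (𝓝 l) := by
    simpa using tendsto_const_nhds.add ENNReal.tendsto_inv_nat_nhds_zero
  obtain ⟨b, hb, h⟩ := hFc.exists_forall_le (H := fun _ => F) (fun _ => hF) le_rfl hB hx hls hl hbs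
    fun m n _ => hbl n
  exact ⟨b, hb, h 0⟩

theorem lowerSemicontinuous_biInf_of_seqInfCompact {B : Set E} (hB : IsClosed B) :
    LowerSemicontinuous fun x => ⨅ b ∈ B, F (x, b) := by
  rw [lowerSemicontinuous_iff_isClosed_preimage]
  intro l
  rcases eq_or_lt_of_le (le_top : l ≤ ⊤) with rfl | hl
  · simp
  refine IsSeqClosed.isClosed fun xs x hxs hx => ?_
  obtain ⟨b, hb, h⟩ := exists_le_of_biInf_le hF hFc hB hx hl hxs
  exact (iInf₂_le (f := fun b _ => F (x, b)) b hb).trans h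

theorem exists_measurable_selector_of_seqInfCompact
    [MeasurableSpace S] [BorelSpace S] [TopologicalSpace.SeparableSpace E]
    [MeasurableSpace E] [BorelSpace E] {w : S → ℝ≥0∞} (hw : Measurable w) (hwt : ∀ x, w x < ⊤)
    (hle : ∀ x, ∃ b, F (x, b) ≤ w x) :
    ∃ φ : S → E, Measurable φ ∧ ∀ x, F (x, φ x) ≤ w x := by
  have hD : IsMeasurableCompactMultifunction fun x => {b | F (x, b) ≤ w x} := by
    refine ⟨fun x => IsSeqCompact.isCompact fun bs hbs => ?_, hle, fun B hB => ?_⟩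
    · obtain ⟨b, ψ, hψ, hb⟩ := hFc (fun _ => x) x bs (w x) tendsto_const_nhds (hwt x) hbs
      refine ⟨b, ?_, ψ, hψ, hb⟩
      have hcl : IsClosed {b | F (x, b) ≤ w x} :=
        (hF.isClosed_preimage (w x)).preimage (Continuous.prodMk_right x)
      exact hcl.mem_of_tendsto hb (Eventually.of_forall fun n => hbs _)
    · have : {x | ({b | F (x, b) ≤ w x} ∩ B).Nonempty} = {x | ⨅ b ∈ B, F (x, b) ≤ w x} := by
        ext x
        constructor
        · rintro ⟨b, hb, hbB⟩
          exact (iInf₂_le (f := fun b _ => F (x, b)) b hbB).trans hb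
        · intro h
          obtain ⟨b, hb, h⟩ := exists_le_of_biInf_le hF hFc hB
            (tendsto_const_nhds (x := x)) (hwt x) fun _ => h
          exact ⟨b, h, hb⟩
      rw [this]
      exact measurableSet_le (lowerSemicontinuous_biInf_of_seqInfCompact hF hFc hB).measurable hw
  exact hD.exists_measurable_selector

end InfCompact

section Recursion

variable {S E : Type*} [MeasurableSpace S] [MeasurableSpace E]

instance MDP.instIsMarkovKernel (M : MDP S E) : IsMarkovKernel M.q := M.markov

instance Policy.instIsMarkovKernel (p : Policy S E) (t : ℕ) : IsMarkovKernel (p.π t) := p.markov t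

theorem measurable_snoc_hist (t : ℕ) :
    Measurable fun z : (Hist S E t × E) × S =>
      ((Fin.snoc z.1.1.1 (z.1.1.2, z.1.2), z.2) : Hist S E (t + 1)) := by
  refine Measurable.prodMk (measurable_pi_lambda _ fun i => ?_) measurable_snd
  induction i using Fin.lastCases with
  | last => simpa using by fun_prop
  | cast j =>
    simp only [Fin.snoc_castSucc]
    exact (measurable_pi_apply j).comp (by fun_prop)

theorem measurable_hist_step (M : MDP S E) (t : ℕ) :
    Measurable fun z : Hist S E t × E =>
      (M.q (z.1.2, z.2)).map fun x' => ((Fin.snoc z.1.1 (z.1.2, z.2), x') : Hist S E (t + 1)) := by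
  refine Measure.measurable_of_measurable_coe _ fun s hs => ?_
  have hmap : ∀ z : Hist S E t × E, Measurable fun x' : S =>
      ((Fin.snoc z.1.1 (z.1.2, z.2), x') : Hist S E (t + 1)) :=
    fun z => (measurable_snoc_hist t).comp measurable_prodMk_left
  have : ∀ z : Hist S E t × E, ((M.q (z.1.2, z.2)).map fun x' =>
      ((Fin.snoc z.1.1 (z.1.2, z.2), x') : Hist S E (t + 1))) s
      = (M.q.comap (fun z : Hist S E t × E => (z.1.2, z.2)) (by fun_prop)) z
        (Prod.mk z ⁻¹' ((fun z : (Hist S E t × E) × S =>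
          ((Fin.snoc z.1.1.1 (z.1.1.2, z.1.2), z.2) : Hist S E (t + 1))) ⁻¹' s)) := by
    intro z
    rw [Measure.map_apply (hmap z) hs, Kernel.comap_apply]
    rfl
  simp only [this]
  exact Kernel.measurable_kernel_prodMk_left (measurable_snoc_hist t hs)

theorem measurable_hist_bind (M : MDP S E) (p : Policy S E) (t : ℕ) :
    Measurable fun h : Hist S E t => ((p.π t) h).bind fun a =>
      (M.q (h.2, a)).map fun x' => ((Fin.snoc h.1 (h.2, a), x') : Hist S E (t + 1)) := by
  refine Measure.measurable_of_measurable_coe _ fun s hs => ?_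
  have hstep := measurable_hist_step M t
  have : ∀ h : Hist S E t, (((p.π t) h).bind fun a =>
      (M.q (h.2, a)).map fun x' => ((Fin.snoc h.1 (h.2, a), x') : Hist S E (t + 1))) s
      = ∫⁻ a, ((M.q (h.2, a)).map fun x' =>
          ((Fin.snoc h.1 (h.2, a), x') : Hist S E (t + 1))) s ∂((p.π t) h) := fun h =>
    Measure.bind_apply hs (hstep.comp measurable_prodMk_left).aemeasurable
  simp only [this]
  exact Measurable.lintegral_kernel_prod_right' (κ := p.π t)
    ((Measure.measurable_coe hs).comp hstep)

variable (M : MDP S E) (p : Policy S E) (x : S)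

theorem lintegral_histMeas_zero {w : S → ℝ≥0∞} (hw : Measurable w) :
    ∫⁻ h, w h.2 ∂(histMeas M p x 0) = w x := by
  have hm : Measurable fun h : Hist S E 0 => w h.2 := hw.comp measurable_snd
  exact lintegral_dirac' _ hm

theorem lintegral_histMeas_succ (t : ℕ) {w : S → ℝ≥0∞} (hw : Measurable w) :
    ∫⁻ h, w h.2 ∂(histMeas M p x (t + 1))
      = ∫⁻ h, ∫⁻ a, ∫⁻ y, w y ∂(M.q (h.2, a)) ∂((p.π t) h) ∂(histMeas M p x t) := by
  have hm : Measurable fun h : Hist S E (t + 1) => w h.2 := hw.comp measurable_snd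
  rw [histMeas, Measure.lintegral_bind (measurable_hist_bind M p t).aemeasurable hm.aemeasurable]
  refine lintegral_congr fun h => ?_
  have hs : Measurable fun a =>
      (M.q (h.2, a)).map fun x' => ((Fin.snoc h.1 (h.2, a), x') : Hist S E (t + 1)) :=
    (measurable_hist_step M t).comp (measurable_prodMk_left (x := h))
  rw [Measure.lintegral_bind hs.aemeasurable hm.aemeasurable]
  refine lintegral_congr fun a => ?_
  exact lintegral_map hm ((measurable_snoc_hist t).comp (measurable_prodMk_left (x := (h, a))))

theorem measurable_saMeas_step (t : ℕ) :
    Measurable fun h : Hist S E t => ((p.π t) h).map fun a => (h.2, a) := by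
  refine Measure.measurable_of_measurable_coe _ fun s hs => ?_
  have : ∀ h : Hist S E t, (((p.π t) h).map fun a => (h.2, a)) s
      = p.π t h (Prod.mk h ⁻¹' ((fun z : Hist S E t × E => (z.1.2, z.2)) ⁻¹' s)) := fun h => by
    rw [Measure.map_apply measurable_prodMk_left hs]
    rfl
  simp only [this]
  exact Kernel.measurable_kernel_prodMk_left
    ((by fun_prop : Measurable fun z : Hist S E t × E => (z.1.2, z.2)) hs)

theorem lintegral_saMeas (t : ℕ) {f : S × E → ℝ≥0∞} (hf : Measurable f) :
    ∫⁻ z, f z ∂(saMeas M p x t)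
      = ∫⁻ h, ∫⁻ a, f (h.2, a) ∂((p.π t) h) ∂(histMeas M p x t) := by
  rw [saMeas, Measure.lintegral_bind (measurable_saMeas_step p t).aemeasurable hf.aemeasurable]
  exact lintegral_congr fun h => lintegral_map hf measurable_prodMk_left

instance isProbabilityMeasure_histMeas (t : ℕ) : IsProbabilityMeasure (histMeas M p x t) := by
  induction t with
  | zero => exact inferInstanceAs (IsProbabilityMeasure (Measure.dirac _))
  | succ t ih =>
    constructor
    rw [← lintegral_one, lintegral_histMeas_succ M p x t (w := fun _ => 1) measurable_const]
    simp

instance isProbabilityMeasure_saMeas (t : ℕ) : IsProbabilityMeasure (saMeas M p x t) := by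
  constructor
  rw [← lintegral_one, lintegral_saMeas M p x t (f := fun _ => 1) measurable_const]
  simp

variable {g : S × E → ℝ≥0∞} {w w' : S → ℝ≥0∞} {β : ℝ≥0∞}

theorem lintegral_saMeas_add (hg : Measurable g) (hw' : Measurable w') (t : ℕ) :
    ∫⁻ h, ∫⁻ a, (g (h.2, a) + β * ∫⁻ y, w' y ∂(M.q (h.2, a))) ∂((p.π t) h) ∂(histMeas M p x t)
      = ∫⁻ z, g z ∂(saMeas M p x t) + β * ∫⁻ h, w' h.2 ∂(histMeas M p x (t + 1)) := by
  have hint : Measurable fun z : S × E => ∫⁻ y, w' y ∂(M.q z) := hw'.lintegral_kernel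
  have hsub : Measurable fun z : Hist S E t × E => (z.1.2, z.2) := by fun_prop
  rw [lintegral_saMeas M p x t hg, lintegral_histMeas_succ M p x t hw', ← lintegral_const_mul,
    ← lintegral_add_left]
  · refine lintegral_congr fun h => ?_
    have hg' : Measurable fun a => g (h.2, a) := hg.comp measurable_prodMk_left
    have hint' : Measurable fun a => ∫⁻ y, w' y ∂(M.q (h.2, a)) := hint.comp measurable_prodMk_left
    rw [lintegral_add_left hg', lintegral_const_mul _ hint']
  · exact Measurable.lintegral_kernel_prod_right' (κ := p.π t) (hg.comp hsub)
  · exact Measurable.lintegral_kernel_prod_right' (κ := p.π t) (hint.comp hsub)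

theorem lintegral_histMeas_le_step (hg : Measurable g) (hw' : Measurable w')
    (h : ∀ x a, w x ≤ g (x, a) + β * ∫⁻ y, w' y ∂(M.q (x, a))) (t : ℕ) :
    ∫⁻ h, w h.2 ∂(histMeas M p x t)
      ≤ ∫⁻ z, g z ∂(saMeas M p x t) + β * ∫⁻ h, w' h.2 ∂(histMeas M p x (t + 1)) := by
  rw [← lintegral_saMeas_add M p x hg hw' t]
  refine lintegral_mono fun z => ?_
  calc w z.2 = ∫⁻ _, w z.2 ∂(p.π t z) := by simp
    _ ≤ _ := lintegral_mono fun a => h z.2 a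

theorem lintegral_histMeas_ge_step {φ : S → E} (hφ : Measurable φ)
    (hg : Measurable g) (hw' : Measurable w')
    (h : ∀ x, g (x, φ x) + β * ∫⁻ y, w' y ∂(M.q (x, φ x)) ≤ w x) (t : ℕ) :
    ∫⁻ z, g z ∂(saMeas M (detPolicy φ hφ) x t)
        + β * ∫⁻ h, w' h.2 ∂(histMeas M (detPolicy φ hφ) x (t + 1))
      ≤ ∫⁻ h, w h.2 ∂(histMeas M (detPolicy φ hφ) x t) := by
  rw [← lintegral_saMeas_add M _ x hg hw' t]
  refine lintegral_mono fun z => ?_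
  have hm : Measurable fun a => g (z.2, a) + β * ∫⁻ y, w' y ∂(M.q (z.2, a)) :=
    (hg.add (measurable_const.mul hw'.lintegral_kernel)).comp measurable_prodMk_left
  have : ∫⁻ a, (g (z.2, a) + β * ∫⁻ y, w' y ∂(M.q (z.2, a))) ∂((detPolicy φ hφ).π t z)
      = g (z.2, φ z.2) + β * ∫⁻ y, w' y ∂(M.q (z.2, φ z.2)) :=
    Kernel.lintegral_deterministic' (g := fun h : Hist S E t => φ h.2)
      (hφ.comp measurable_snd) hm
  exact this.trans_le (h z.2)

end Recursion

section Discounted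

variable {S E : Type*} [MeasurableSpace S] [MeasurableSpace E]

/-- Expected total discounted cost of a policy for a nonnegative cost `g`. -/
def discVal (M : MDP S E) (g : S × E → ℝ≥0∞) (β : ℝ≥0∞) (p : Policy S E) (x : S) : ℝ≥0∞ :=
  ∑' t, β ^ t * ∫⁻ z, g z ∂(saMeas M p x t)

/-- Optimal expected total discounted cost for a nonnegative cost `g`. -/
def discOpt (M : MDP S E) (g : S × E → ℝ≥0∞) (β : ℝ≥0∞) (x : S) : ℝ≥0∞ :=
  ⨅ p, discVal M g β p x

/-- One-step cost plus discounted expected cost-to-go `w`. -/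
def actionVal (M : MDP S E) (g : S × E → ℝ≥0∞) (β : ℝ≥0∞) (w : S → ℝ≥0∞) (z : S × E) : ℝ≥0∞ :=
  g z + β * ∫⁻ y, w y ∂(M.q z)

/-- Value iteration started at zero. -/
def valueIter (M : MDP S E) (g : S × E → ℝ≥0∞) (β : ℝ≥0∞) : ℕ → S → ℝ≥0∞
  | 0 => fun _ => 0
  | N + 1 => fun x => ⨅ a, actionVal M g β (valueIter M g β N) (x, a)

theorem actionVal_mono (M : MDP S E) (g : S × E → ℝ≥0∞) {β β' : ℝ≥0∞} (hβ : β ≤ β')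
    {w w' : S → ℝ≥0∞} (h : w ≤ w') : actionVal M g β w ≤ actionVal M g β' w' :=
  fun _ => add_le_add le_rfl (mul_le_mul' hβ (lintegral_mono h))

theorem le_actionVal (M : MDP S E) (g : S × E → ℝ≥0∞) (β : ℝ≥0∞) (w : S → ℝ≥0∞) :
    g ≤ actionVal M g β w :=
  fun _ => le_self_add

theorem valueIter_monotone (M : MDP S E) (g : S × E → ℝ≥0∞) (β : ℝ≥0∞) :
    Monotone (valueIter M g β) := by
  refine monotone_nat_of_le_succ fun N => ?_
  induction N with
  | zero => exact fun x => bot_le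
  | succ N ih => exact fun x => iInf_mono fun a => actionVal_mono M g le_rfl ih (x, a)

theorem lintegral_valueIter_le {M : MDP S E} {g : S × E → ℝ≥0∞} {β : ℝ≥0∞} (hg : Measurable g)
    (hv : ∀ N, Measurable (valueIter M g β N)) (p : Policy S E) (x : S) (N : ℕ) :
    ∀ k, ∫⁻ h, valueIter M g β N h.2 ∂(histMeas M p x k)
      ≤ ∑ t ∈ Finset.range N, β ^ t * ∫⁻ z, g z ∂(saMeas M p x (k + t)) := by
  induction N with
  | zero => intro k; simp [valueIter]
  | succ N ih =>
    intro k
    refine (lintegral_histMeas_le_step M p x hg (hv N)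
      (fun x a => iInf_le (fun a => actionVal M g β (valueIter M g β N) (x, a)) a) k).trans ?_
    rw [Finset.sum_range_succ', add_comm]
    simp only [pow_zero, one_mul, add_zero]
    gcongr
    refine (mul_le_mul_right (ih (k + 1)) β).trans_eq ?_
    rw [Finset.mul_sum]
    refine Finset.sum_congr rfl fun t _ => ?_
    rw [pow_succ', mul_assoc, add_assoc, add_comm 1 t]

theorem valueIter_le_discOpt {M : MDP S E} {g : S × E → ℝ≥0∞} {β : ℝ≥0∞} (hg : Measurable g)
    (hv : ∀ N, Measurable (valueIter M g β N)) (N : ℕ) : valueIter M g β N ≤ discOpt M g β := by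
  refine fun x => le_iInf fun p => ?_
  rw [← lintegral_histMeas_zero M p x (hv N)]
  refine (lintegral_valueIter_le hg hv p x N 0).trans ?_
  simp only [zero_add]
  exact ENNReal.sum_le_tsum _

theorem sum_add_le_of_actionVal_le {M : MDP S E} {g : S × E → ℝ≥0∞} {β : ℝ≥0∞} (hg : Measurable g)
    {φ : S → E} (hφ : Measurable φ) {w : S → ℝ≥0∞} (hw : Measurable w)
    (h : ∀ x, actionVal M g β w (x, φ x) ≤ w x) (x : S) (N : ℕ) :
    ∑ t ∈ Finset.range N, β ^ t * ∫⁻ z, g z ∂(saMeas M (detPolicy φ hφ) x t)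
      + β ^ N * ∫⁻ h, w h.2 ∂(histMeas M (detPolicy φ hφ) x N) ≤ w x := by
  induction N with
  | zero => simp [lintegral_histMeas_zero M (detPolicy φ hφ) x hw]
  | succ N ih =>
    refine le_trans ?_ ih
    rw [Finset.sum_range_succ, add_assoc]
    gcongr
    rw [pow_succ, mul_assoc, ← mul_add]
    gcongr
    exact lintegral_histMeas_ge_step M x hφ hg hw h N

theorem discVal_le_of_actionVal_le {M : MDP S E} {g : S × E → ℝ≥0∞} {β : ℝ≥0∞} (hg : Measurable g)
    {φ : S → E} (hφ : Measurable φ) {w : S → ℝ≥0∞} (hw : Measurable w)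
    (h : ∀ x, actionVal M g β w (x, φ x) ≤ w x) (x : S) :
    discVal M g β (detPolicy φ hφ) x ≤ w x :=
  ENNReal.tsum_le_of_sum_range_le fun N =>
    le_self_add.trans (sum_add_le_of_actionVal_le hg hφ hw h x N)

theorem sum_le_of_average_inequality {M : MDP S E} {g : S × E → ℝ≥0∞} (hg : Measurable g)
    {φ : S → E} (hφ : Measurable φ) {u : S → ℝ≥0∞} (hu : Measurable u) {W : ℝ≥0∞}
    (h : ∀ x, actionVal M g 1 u (x, φ x) ≤ W + u x) (x : S) (N : ℕ) :
    ∑ t ∈ Finset.range N, ∫⁻ z, g z ∂(saMeas M (detPolicy φ hφ) x t)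
      + ∫⁻ h, u h.2 ∂(histMeas M (detPolicy φ hφ) x N) ≤ N * W + u x := by
  induction N with
  | zero => simp [lintegral_histMeas_zero M (detPolicy φ hφ) x hu]
  | succ N ih =>
    have hstep := lintegral_histMeas_ge_step M x hφ hg hu (w := fun x => W + u x) h N
    rw [lintegral_add_left measurable_const] at hstep
    simp only [one_mul, lintegral_const, measure_univ, mul_one] at hstep
    calc _ = ∑ t ∈ Finset.range N, ∫⁻ z, g z ∂(saMeas M (detPolicy φ hφ) x t)
          + (∫⁻ z, g z ∂(saMeas M (detPolicy φ hφ) x N)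
            + ∫⁻ h, u h.2 ∂(histMeas M (detPolicy φ hφ) x (N + 1))) := by
          rw [Finset.sum_range_succ, add_assoc]
      _ ≤ _ := add_le_add le_rfl hstep
      _ = W + (∑ t ∈ Finset.range N, ∫⁻ z, g z ∂(saMeas M (detPolicy φ hφ) x t)
          + ∫⁻ h, u h.2 ∂(histMeas M (detPolicy φ hφ) x N)) := by ring
      _ ≤ W + (N * W + u x) := add_le_add le_rfl ih
      _ = _ := by push_cast; ring

theorem actionVal_discOpt_eq {M : MDP S E} {g : S × E → ℝ≥0∞} {b : ℝ≥0∞} {m : ℝ≥0∞} (hmV : ∀ x, m ≤ discOpt M g b x)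
    (z : S × E) : actionVal M g b (discOpt M g b) z
      = actionVal M g b (fun x => discOpt M g b x - m) z + b * m := by
  have : ∫⁻ y, discOpt M g b y ∂(M.q z) = ∫⁻ y, (discOpt M g b y - m) ∂(M.q z) + m := by
    calc _ = ∫⁻ y, ((discOpt M g b y - m) + m) ∂(M.q z) :=
          lintegral_congr fun y => (tsub_add_cancel_of_le (hmV y)).symm
      _ = _ := by rw [lintegral_add_right _ measurable_const]; simp
  simp only [actionVal, this, mul_add, add_assoc]

end Discounted

section Optimality

variable {S E : Type*} [MetricSpace S] [MeasurableSpace S] [BorelSpace S]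
  [MetricSpace E] [MeasurableSpace E] {M : MDP S E} {g : S × E → ℝ≥0∞} {β : ℝ≥0∞}

theorem lowerSemicontinuous_actionVal
    (hq : ∀ f : BoundedContinuousFunction S ℝ, Continuous fun z => ∫ y, f y ∂(M.q z))
    (hg : LowerSemicontinuous g) (hβ : β ≠ ⊤) {w : S → ℝ≥0∞} (hw : LowerSemicontinuous w) :
    LowerSemicontinuous (actionVal M g β w) :=
  hg.add ((ENNReal.continuous_const_mul hβ).comp_lowerSemicontinuous
    (hw.lintegral_of_weakly_continuous (fun z => M.q z) hq) fun _ _ h => mul_le_mul_right h β)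

variable (hq : ∀ f : BoundedContinuousFunction S ℝ, Continuous fun z => ∫ y, f y ∂(M.q z))
  (hg : LowerSemicontinuous g) (hgc : SeqInfCompact g) (hβ : β ≠ ⊤)
include hq hg hgc hβ

theorem lowerSemicontinuous_valueIter (N : ℕ) : LowerSemicontinuous (valueIter M g β N) := by
  induction N with
  | zero => exact lowerSemicontinuous_const
  | succ N ih =>
    simpa [valueIter] using lowerSemicontinuous_biInf_of_seqInfCompact
      (lowerSemicontinuous_actionVal hq hg hβ ih) (hgc.mono (le_actionVal M g β _)) isClosed_univ

variable [SecondCountableTopology E] [BorelSpace E]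

/-- The discounted value function is lower semicontinuous and satisfies the optimality equation,
with the minimum attained. -/
theorem discOpt_optimality (hfin : ∀ x, discOpt M g β x < ⊤) :
    LowerSemicontinuous (discOpt M g β) ∧
      (∀ z : S × E, discOpt M g β z.1 ≤ actionVal M g β (discOpt M g β) z) ∧
      ∀ x, ∃ b, actionVal M g β (discOpt M g β) (x, b) ≤ discOpt M g β x := by
  have hlsc := lowerSemicontinuous_valueIter hq hg hgc hβ
  have hvm : ∀ N, Measurable (valueIter M g β N) := fun N => (hlsc N).measurable
  set v : S → ℝ≥0∞ := fun x => ⨆ N, valueIter M g β N x with hv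
  have hvlsc : LowerSemicontinuous v := lowerSemicontinuous_iSup hlsc
  have hvle : v ≤ discOpt M g β := fun x =>
    iSup_le fun N => valueIter_le_discOpt hg.measurable hvm N x
  have hsup : ∀ z, actionVal M g β v z = ⨆ N, actionVal M g β (valueIter M g β N) z := by
    intro z
    simp only [actionVal, hv]
    rw [lintegral_iSup hvm (valueIter_monotone M g β), ENNReal.mul_iSup, ENNReal.add_iSup]
  have hex : ∀ x, ∃ b, actionVal M g β v (x, b) ≤ v x := by
    intro x
    have hvx : v x < ⊤ := (hvle x).trans_lt (hfin x)
    have hmin : ∀ N, ∃ b, actionVal M g β (valueIter M g β N) (x, b) ≤ v x := by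
      intro N
      obtain ⟨b, -, hb⟩ := exists_le_of_biInf_le (lowerSemicontinuous_actionVal hq hg hβ (hlsc N))
        (hgc.mono (le_actionVal M g β _)) isClosed_univ (tendsto_const_nhds (x := x)) hvx
        fun _ => by
          simp only [mem_univ, iInf_pos]
          exact le_iSup (fun N => valueIter M g β N x) (N + 1)
      exact ⟨b, hb⟩
    choose bs hbs using hmin
    obtain ⟨b, -, hb⟩ := hgc.exists_forall_le
      (fun N => lowerSemicontinuous_actionVal hq hg hβ (hlsc N)) (le_actionVal M g β _)
      isClosed_univ (tendsto_const_nhds (x := x)) (tendsto_const_nhds (x := v x)) hvx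
      (fun n => mem_univ (bs n)) fun m n hmn =>
        (actionVal_mono M g le_rfl (valueIter_monotone M g β hmn) _).trans (hbs n)
    exact ⟨b, by rw [hsup]; exact iSup_le hb⟩
  obtain ⟨φ, hφ, hφv⟩ := exists_measurable_selector_of_seqInfCompact
    (lowerSemicontinuous_actionVal hq hg hβ hvlsc) (hgc.mono (le_actionVal M g β _))
    hvlsc.measurable (fun x => (hvle x).trans_lt (hfin x)) hex
  have heq : discOpt M g β = v := le_antisymm (fun x => (iInf_le _ (detPolicy φ hφ)).trans
    (discVal_le_of_actionVal_le hg.measurable hφ hvlsc.measurable hφv x)) hvle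
  rw [heq]
  refine ⟨hvlsc, fun z => iSup_le fun N => ?_, hex⟩
  refine ((valueIter_monotone M g β (Nat.le_succ N)) z.1).trans ?_
  exact (iInf_le _ z.2).trans (actionVal_mono M g le_rfl
    (fun y => le_iSup (fun N => valueIter M g β N y) N) _)

end Optimality

section Abel

/-- Abelian estimate: partial sums growing at most linearly bound discounted partial sums. -/
theorem sum_pow_mul_le_of_sum_le {β r : ℝ≥0∞} (hβ : β ≤ 1) (hr : r ≠ ⊤) (N : ℕ) :
    ∀ (G : ℕ → ℝ≥0∞) (C : ℝ≥0∞), C ≠ ⊤ → (∀ n, ∑ t ∈ Finset.range n, G t ≤ C + n * r) →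
      ∑ t ∈ Finset.range N, β ^ t * G t ≤ C + r * ∑ t ∈ Finset.range N, β ^ t := by
  induction N with
  | zero => simp
  | succ N ih =>
    intro G C hC hG
    have h0 : G 0 ≤ C + r := by simpa using hG 1
    have hfin : C + r ≠ ⊤ := ENNReal.add_ne_top.2 ⟨hC, hr⟩
    have h0' : G 0 ≠ ⊤ := (h0.trans_lt hfin.lt_top).ne
    have htail : ∑ t ∈ Finset.range N, β ^ t * G (t + 1)
        ≤ (C + r - G 0) + r * ∑ t ∈ Finset.range N, β ^ t := by
      refine ih (fun t => G (t + 1)) (C + r - G 0) (ENNReal.sub_ne_top hfin) fun n => ?_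
      have := hG (n + 1)
      rw [Finset.sum_range_succ'] at this
      refine (ENNReal.add_le_add_iff_right h0').1 (this.trans_eq ?_)
      rw [add_right_comm, tsub_add_cancel_of_le h0]
      push_cast
      ring
    rw [Finset.sum_range_succ', Finset.sum_range_succ']
    simp only [pow_zero, one_mul, pow_succ', mul_assoc, ← Finset.mul_sum]
    calc β * ∑ t ∈ Finset.range N, β ^ t * G (t + 1) + G 0
        ≤ β * ((C + r - G 0) + r * ∑ t ∈ Finset.range N, β ^ t) + G 0 := by gcongr
      _ ≤ 1 * (C + r - G 0) + β * (r * ∑ t ∈ Finset.range N, β ^ t) + G 0 := by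
          rw [mul_add]; gcongr
      _ = (C + r - G 0 + G 0) + β * (r * ∑ t ∈ Finset.range N, β ^ t) := by ring
      _ = _ := by rw [tsub_add_cancel_of_le h0]; ring

theorem exists_one_sub_mul_tsum_le {G : ℕ → ℝ≥0∞} {r : ℝ≥0∞} (hr : r ≠ ⊤)
    (hG : ∀ᶠ N : ℕ in atTop, ∑ t ∈ Finset.range N, G t ≤ N * r) :
    ∃ C : ℝ≥0∞, C ≠ ⊤ ∧ ∀ β < 1, (1 - β) * ∑' t, β ^ t * G t ≤ (1 - β) * C + r := by
  obtain ⟨N₀, hN₀⟩ := eventually_atTop.1 hG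
  refine ⟨N₀ * r, ENNReal.mul_ne_top (ENNReal.natCast_ne_top _) hr, fun β hβ => ?_⟩
  have hbound : ∀ n, ∑ t ∈ Finset.range n, G t ≤ N₀ * r + n * r := by
    intro n
    rcases le_total N₀ n with h | h
    · exact (hN₀ n h).trans le_add_self
    · exact (Finset.sum_le_sum_of_subset (Finset.range_mono h)).trans
        ((hN₀ N₀ le_rfl).trans le_self_add)
  have htsum : ∑' t, β ^ t * G t ≤ N₀ * r + r * (1 - β)⁻¹ := by
    refine ENNReal.tsum_le_of_sum_range_le fun N => ?_
    refine (sum_pow_mul_le_of_sum_le hβ.le hr N G _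
      (ENNReal.mul_ne_top (ENNReal.natCast_ne_top _) hr) hbound).trans ?_
    gcongr
    rw [← ENNReal.tsum_geometric]
    exact ENNReal.sum_le_tsum _
  calc (1 - β) * ∑' t, β ^ t * G t ≤ (1 - β) * (N₀ * r + r * (1 - β)⁻¹) := by gcongr
    _ = (1 - β) * (N₀ * r) + r * ((1 - β) * (1 - β)⁻¹) := by ring
    _ = _ := by
      rw [ENNReal.mul_inv_cancel (tsub_pos_of_lt hβ).ne'
        (ENNReal.sub_ne_top ENNReal.one_ne_top), mul_one]

end Abel

section UniformIntegrability

variable {S : Type*} [MeasurableSpace S]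

/-- The upper limit of integrals of an asymptotically uniformly integrable sequence, perturbed by
a convergent lower bound, is controlled by the integral of the pointwise limit. -/
theorem le_add_lintegral_of_asymptotic_unifIntegrable {μ : Measure S} [IsFiniteMeasure μ]
    {U : ℕ → S → ℝ≥0∞} (hU : ∀ n, Measurable (U n)) {u : S → ℝ≥0∞}
    (hlim : ∀ x, Tendsto (fun n => U n x) atTop (𝓝 (u x)))
    (hui : Tendsto (fun K : ℝ => limsup (fun n =>
      ∫⁻ y in {y | ENNReal.ofReal K ≤ U n y}, U n y ∂μ) atTop) atTop (𝓝 0))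
    {ls : ℕ → ℝ≥0∞} {l c : ℝ≥0∞} (hls : Tendsto ls atTop (𝓝 l))
    (hle : ∀ n, ls n ≤ c + ∫⁻ y, U n y ∂μ) : l ≤ c + ∫⁻ y, u y ∂μ := by
  have key : ∀ (K : ℝ) (b : ℝ≥0∞), limsup (fun n =>
      ∫⁻ y in {y | ENNReal.ofReal K ≤ U n y}, U n y ∂μ) atTop < b → l ≤ c + ∫⁻ y, u y ∂μ + b := by
    intro K b hb
    have hsplit : ∀ n, ∫⁻ y, U n y ∂μ ≤ ∫⁻ y, min (U n y) (ENNReal.ofReal K) ∂μ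
        + ∫⁻ y in {y | ENNReal.ofReal K ≤ U n y}, U n y ∂μ := by
      intro n
      have hs : MeasurableSet {y | ENNReal.ofReal K ≤ U n y} :=
        measurableSet_le measurable_const (hU n)
      rw [← lintegral_indicator hs, ← lintegral_add_left ((hU n).min measurable_const)]
      refine lintegral_mono fun y => ?_
      by_cases hy : ENNReal.ofReal K ≤ U n y
      · rw [indicator_of_mem (by exact hy)]
        exact le_add_self
      · rw [min_eq_left (not_le.1 hy).le]
        exact le_self_add
    have htrunc : Tendsto (fun n => ∫⁻ y, min (U n y) (ENNReal.ofReal K) ∂μ) atTop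
        (𝓝 (∫⁻ y, min (u y) (ENNReal.ofReal K) ∂μ)) := by
      refine tendsto_lintegral_of_dominated_convergence (fun _ => ENNReal.ofReal K)
        (fun n => (hU n).min measurable_const) (fun n => ae_of_all _ fun y => min_le_right _ _) ?_
        (ae_of_all _ fun y => (hlim y).min tendsto_const_nhds)
      rw [lintegral_const]
      exact ENNReal.mul_ne_top ENNReal.ofReal_ne_top (measure_ne_top μ _)
    have hlim' := (tendsto_const_nhds (x := c)).add htrunc |>.add (tendsto_const_nhds (x := b))
    refine (le_of_tendsto_of_tendsto hls hlim' ?_).trans ?_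
    · filter_upwards [eventually_lt_of_limsup_lt hb] with n hn
      refine (hle n).trans ?_
      rw [add_assoc]
      gcongr
      exact (hsplit n).trans (by gcongr)
    · gcongr
      exact min_le_left _ _
  refine ENNReal.le_of_forall_pos_le_add fun ε hε _ => ?_
  obtain ⟨K, hK⟩ := (hui.eventually (gt_mem_nhds (ENNReal.coe_pos.2 hε))).exists
  exact key K ε hK

end UniformIntegrability

section VanishingDiscount

variable {S E : Type*} [MetricSpace S] [MeasurableSpace S] [BorelSpace S]
  [MetricSpace E] [SecondCountableTopology E] [MeasurableSpace E] [BorelSpace E]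
  {M : MDP S E} {g : S × E → ℝ≥0∞} {β : ℕ → ℝ≥0∞}

/-- Vanishing discount limit for nonnegative costs: relative value functions that are lower
semi-equicontinuous, convergent and asymptotically uniformly integrable yield the average-cost
optimality equation. -/
theorem exists_selector_of_vanishing_discount
    (hq : ∀ f : BoundedContinuousFunction S ℝ, Continuous fun z => ∫ y, f y ∂(M.q z))
    (hg : LowerSemicontinuous g) (hgc : SeqInfCompact g)
    (hβ1 : ∀ n, β n ≤ 1) (hβm : Monotone β) (hβ : Tendsto β atTop (𝓝 1))
    (hfin : ∀ n x, discOpt M g (β n) x < ⊤) {m : ℕ → ℝ≥0∞} (hm : ∀ n, m n ≠ ⊤)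
    (hmV : ∀ n x, m n ≤ discOpt M g (β n) x)
    (hlsc : ∀ N, LowerSemicontinuous fun x => ⨅ k ≥ N, (discOpt M g (β k) x - m k))
    {u : S → ℝ≥0∞} (hu : ∀ x, u x < ⊤)
    (hlim : ∀ x, Tendsto (fun n => discOpt M g (β n) x - m n) atTop (𝓝 (u x)))
    (hui : ∀ z : S × E, Tendsto (fun K : ℝ => limsup (fun n =>
      ∫⁻ y in {y | ENNReal.ofReal K ≤ discOpt M g (β n) y - m n},
        (discOpt M g (β n) y - m n) ∂(M.q z)) atTop) atTop (𝓝 0))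
    {W : ℝ≥0∞} (hW : W < ⊤) (hWlim : Tendsto (fun n => (1 - β n) * m n) atTop (𝓝 W)) :
    Measurable u ∧ (∃ φ : S → E, Measurable φ ∧ ∀ x, actionVal M g 1 u (x, φ x) ≤ W + u x) ∧
      ∀ z : S × E, W + u z.1 ≤ actionVal M g 1 u z := by
  set U : ℕ → S → ℝ≥0∞ := fun n x => discOpt M g (β n) x - m n with hU
  have hβt : ∀ n, β n ≠ ⊤ := fun n => ((hβ1 n).trans_lt ENNReal.one_lt_top).ne
  have hopt := fun n => discOpt_optimality hq hg hgc (hβt n) (hfin n)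
  have hUm : ∀ n, Measurable (U n) := fun n => (hopt n).1.measurable.sub measurable_const
  have hbm : ∀ n, β n * m n ≠ ⊤ := fun n => ENNReal.mul_ne_top (hβt n) (hm n)
  have hVeq : ∀ n x, discOpt M g (β n) x = (1 - β n) * m n + U n x + β n * m n := by
    intro n x
    calc discOpt M g (β n) x = U n x + m n := (tsub_add_cancel_of_le (hmV n x)).symm
      _ = U n x + ((1 - β n) + β n) * m n := by rw [tsub_add_cancel_of_le (hβ1 n), one_mul]
      _ = _ := by ring
  have hlower : ∀ n z, (1 - β n) * m n + U n z.1 ≤ actionVal M g (β n) (U n) z := by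
    intro n z
    have := (hopt n).2.1 z
    rw [actionVal_discOpt_eq (hmV n), hVeq] at this
    exact (ENNReal.add_le_add_iff_right (hbm n)).1 this
  have hupper : ∀ n x, ∃ b, actionVal M g (β n) (U n) (x, b) ≤ (1 - β n) * m n + U n x := by
    intro n x
    obtain ⟨b, hb⟩ := (hopt n).2.2 x
    rw [actionVal_discOpt_eq (hmV n), hVeq] at hb
    exact ⟨b, (ENNReal.add_le_add_iff_right (hbm n)).1 hb⟩
  set L : ℕ → S → ℝ≥0∞ := fun N x => ⨅ k ≥ N, U k x with hL
  have hLmono : Monotone L := fun N N' h x => biInf_mono fun k hk => le_trans h hk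
  have hLU : ∀ N k, N ≤ k → L N ≤ U k := fun N k h x => iInf₂_le (f := fun k _ => U k x) k h
  have husup : ∀ x, u x = ⨆ N, L N x := fun x => by
    rw [← (hlim x).liminf_eq, liminf_eq_iSup_iInf_of_nat]
  have hulsc : LowerSemicontinuous u := by
    rw [funext husup]
    exact lowerSemicontinuous_iSup hlsc
  have hls : ∀ x, Tendsto (fun n => (1 - β n) * m n + U n x) atTop (𝓝 (W + u x)) :=
    fun x => hWlim.add (hlim x)
  refine ⟨hulsc.measurable, ?_, fun z => ?_⟩
  · refine exists_measurable_selector_of_seqInfCompact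
      (lowerSemicontinuous_actionVal hq hg ENNReal.one_ne_top hulsc)
      (hgc.mono (le_actionVal M g 1 u)) (measurable_const.add hulsc.measurable)
      (fun x => ENNReal.add_lt_top.2 ⟨hW, hu x⟩) fun x => ?_
    choose bs hbs using fun n => hupper n x
    obtain ⟨b, -, hb⟩ := hgc.exists_forall_le
      (fun N => lowerSemicontinuous_actionVal hq hg (hβt N) (hlsc N)) (le_actionVal M g _ _)
      isClosed_univ (tendsto_const_nhds (x := x)) (hls x) (ENNReal.add_lt_top.2 ⟨hW, hu x⟩)
      (fun n => mem_univ (bs n)) fun N n hNn =>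
        (actionVal_mono M g (hβm hNn) (hLU N n hNn) _).trans (hbs n)
    refine ⟨b, ?_⟩
    have hint : Tendsto (fun N => ∫⁻ y, L N y ∂(M.q (x, b))) atTop
        (𝓝 (∫⁻ y, u y ∂(M.q (x, b)))) := by
      refine lintegral_tendsto_of_tendsto_of_monotone (fun N => (hlsc N).measurable.aemeasurable)
        (ae_of_all _ fun y N N' h => hLmono h y) (ae_of_all _ fun y => ?_)
      rw [husup y]
      exact tendsto_atTop_iSup fun N N' h => hLmono h y
    have hprod := ENNReal.Tendsto.mul hβ (Or.inl one_ne_zero) hint (Or.inr ENNReal.one_ne_top)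
    exact le_of_tendsto' (tendsto_const_nhds.add hprod) hb
  · simp only [actionVal, one_mul]
    refine le_add_lintegral_of_asymptotic_unifIntegrable hUm hlim (hui z) (hls z.1) fun n => ?_
    refine (hlower n z).trans ?_
    refine (actionVal_mono M g (hβ1 n) le_rfl z).trans_eq ?_
    simp only [actionVal, one_mul]

end VanishingDiscount

section ExtendedReals

theorem eToENN_coe_real (r : ℝ) : eToENN (r : EReal) = ENNReal.ofReal r := by
  simp [eToENN]

theorem eToENN_coe_ennreal (u : ℝ≥0∞) : eToENN (u : EReal) = u :=
  EReal.toENNReal_coe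

theorem EReal.coe_le_coe_ennreal_iff {K : ℝ} {U : ℝ≥0∞} :
    (K : EReal) ≤ (U : EReal) ↔ ENNReal.ofReal K ≤ U := by
  induction U using ENNReal.recTopCoe with
  | top => simp
  | coe U =>
    rw [EReal.coe_nnreal_eq_coe_real, EReal.coe_le_coe_iff, ENNReal.ofReal,
      ENNReal.coe_le_coe, Real.toNNReal_le_iff_le_coe]

theorem EReal.coe_ennreal_eq_coe_toReal {U : ℝ≥0∞} (hU : U ≠ ⊤) :
    (U : EReal) = ((U.toReal : ℝ) : EReal) := by
  lift U to ℝ≥0 using hU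
  rfl

theorem eToENN_coe_add_coe (r : ℝ) (f : ℝ≥0∞) :
    eToENN ((r : EReal) + f) + ENNReal.ofReal (-r)
      = ENNReal.ofReal r + (f + eToENN (-((r : EReal) + f))) := by
  induction f using ENNReal.recTopCoe with
  | top => simp [eToENN]
  | coe f =>
    have hf : (0 : ℝ) ≤ f := f.2
    rw [EReal.coe_nnreal_eq_coe_real, ← EReal.coe_add, ← EReal.coe_neg, eToENN_coe_real,
      eToENN_coe_real, ← ENNReal.ofReal_coe_nnreal]
    rcases le_total 0 r with h | h <;> rcases le_total 0 (r + f) with h' | h'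
    · rw [ENNReal.ofReal_of_nonpos (by linarith : -(r + (f : ℝ)) ≤ 0),
        ENNReal.ofReal_of_nonpos (by linarith : -r ≤ 0), ENNReal.ofReal_add h hf]
      simp
    · have : r = 0 := by linarith
      have : (f : ℝ) = 0 := by linarith
      simp_all
    · rw [ENNReal.ofReal_of_nonpos (by linarith : -(r + (f : ℝ)) ≤ 0), ENNReal.ofReal_of_nonpos h,
        ← ENNReal.ofReal_add h' (by linarith)]
      simp
    · rw [ENNReal.ofReal_of_nonpos h', ENNReal.ofReal_of_nonpos h,
        ← ENNReal.ofReal_add hf (by linarith)]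
      simp

theorem eInt_coe_add_coe {Y : Type*} [MeasurableSpace Y] {μ : Measure Y} {r : Y → ℝ}
    (hr : Integrable r μ) {f : Y → ℝ≥0∞} (hf : Measurable f) :
    eInt μ (fun y => (r y : EReal) + f y)
      = ((∫ y, r y ∂μ : ℝ) : EReal) + ((∫⁻ y, f y ∂μ : ℝ≥0∞) : EReal) := by
  have hrm := hr.aestronglyMeasurable.aemeasurable
  have hrm' : AEMeasurable (fun y => -r y) μ := hrm.neg
  have key : ∫⁻ y, eToENN ((r y : EReal) + f y) ∂μ + ∫⁻ y, ENNReal.ofReal (-r y) ∂μ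
      = ∫⁻ y, ENNReal.ofReal (r y) ∂μ
        + (∫⁻ y, f y ∂μ + ∫⁻ y, eToENN (-((r y : EReal) + f y)) ∂μ) := by
    rw [← lintegral_add_right' _ hrm'.ennreal_ofReal, ← lintegral_add_left hf,
      ← lintegral_add_left' hrm.ennreal_ofReal]
    exact lintegral_congr fun y => eToENN_coe_add_coe _ _
  have hpos : ∫⁻ y, ENNReal.ofReal (r y) ∂μ ≠ ⊤ := hr.lintegral_lt_top.ne
  have hneg : ∫⁻ y, ENNReal.ofReal (-r y) ∂μ ≠ ⊤ := hr.neg.lintegral_lt_top.ne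
  have hN : ∫⁻ y, eToENN (-((r y : EReal) + f y)) ∂μ ≠ ⊤ := by
    refine ((lintegral_mono fun y => ?_).trans_lt hneg.lt_top).ne
    rw [← eToENN_coe_real, EReal.coe_neg]
    exact EReal.toENNReal_le_toENNReal (EReal.neg_le_neg_iff.2
      (le_add_of_nonneg_right (EReal.coe_ennreal_nonneg _)))
  rw [eInt, integral_eq_lintegral_pos_part_sub_lintegral_neg_part hr]
  generalize ∫⁻ y, eToENN ((r y : EReal) + f y) ∂μ = P at *
  generalize ∫⁻ y, eToENN (-((r y : EReal) + f y)) ∂μ = N at *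
  generalize ∫⁻ y, ENNReal.ofReal (r y) ∂μ = R at *
  generalize ∫⁻ y, ENNReal.ofReal (-r y) ∂μ = R' at *
  generalize ∫⁻ y, f y ∂μ = F at *
  lift N to ℝ≥0 using hN
  lift R to ℝ≥0 using hpos
  lift R' to ℝ≥0 using hneg
  induction F using ENNReal.recTopCoe with
  | top =>
    have : P = ⊤ := by simpa using key
    simp only [this, EReal.coe_ennreal_top, EReal.coe_nnreal_eq_coe_real, ENNReal.coe_toReal,
      EReal.top_sub_coe, EReal.coe_add_top]
  | coe F =>
    have hP : P ≠ ⊤ := fun h => by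
      rw [h, top_add] at key
      exact absurd key.symm (by simp)
    lift P to ℝ≥0 using hP
    have key' : (P : ℝ) + R' = R + (F + N) := by exact_mod_cast key
    simp only [EReal.coe_nnreal_eq_coe_real, ENNReal.coe_toReal, ← EReal.coe_sub, ← EReal.coe_add,
      EReal.coe_eq_coe_iff]
    linarith

theorem eInt_coe_ennreal {Y : Type*} [MeasurableSpace Y] (μ : Measure Y) {f : Y → ℝ≥0∞}
    (hf : Measurable f) : eInt μ (fun y => (f y : EReal)) = ((∫⁻ y, f y ∂μ : ℝ≥0∞) : EReal) := by
  simpa using eInt_coe_add_coe (integrable_zero Y ℝ μ) hf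

theorem eSum_eq_eInt_count (f : ℕ → EReal) : eSum f = eInt Measure.count f := by
  simp [eSum, eInt, lintegral_count]

theorem EReal.continuous_coe_add_coe_ennreal (ρ : ℝ) :
    Continuous fun z : ℝ≥0∞ => (ρ : EReal) + z :=
  continuous_iff_continuousAt.2 fun z =>
    ContinuousAt.comp (f := fun z : ℝ≥0∞ => ((ρ : EReal), (z : EReal)))
      (EReal.continuousAt_add (by simp) (by simp))
      (continuousAt_const.prodMk continuous_coe_ennreal_ereal.continuousAt)

theorem EReal.coe_add_coe_ennreal_le_iff {ρ : ℝ} {z w : ℝ≥0∞} :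
    (ρ : EReal) + z ≤ ρ + w ↔ z ≤ w :=
  (EReal.addLECancellable_coe ρ).add_le_add_iff_left.trans EReal.coe_ennreal_le_coe_ennreal_iff

theorem EReal.iInf_coe_add_coe_ennreal {ι : Sort*} (ρ : ℝ) (f : ι → ℝ≥0∞) :
    ⨅ i, ((ρ : EReal) + f i) = ρ + ((⨅ i, f i : ℝ≥0∞) : EReal) :=
  (Monotone.map_iInf_of_continuousAt (f := fun z : ℝ≥0∞ => (ρ : EReal) + z)
    (continuous_coe_add_coe_ennreal ρ).continuousAt
    (fun _ _ h => coe_add_coe_ennreal_le_iff.2 h) (by simp)).symm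

theorem EReal.coe_mul_coe_add_coe_ennreal {s : ℝ} (hs : 0 ≤ s) (κ : ℝ) (G : ℝ≥0∞) :
    (s : EReal) * ((κ : EReal) + G)
      = ((s * κ : ℝ) : EReal) + ((ENNReal.ofReal s * G : ℝ≥0∞) : EReal) := by
  rw [EReal.coe_ennreal_mul, EReal.coe_ennreal_ofReal, max_eq_left hs, EReal.coe_mul]
  exact EReal.left_distrib_of_nonneg_of_ne_top (EReal.coe_nonneg.2 hs) (EReal.coe_ne_top _) _ _

end ExtendedReals
section CostShift

variable {S E : Type*} [MeasurableSpace S] [MeasurableSpace E]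

/-- The one-step cost shifted by a constant `κ`, truncated below at zero. -/
def MDP.shiftedCost (M : MDP S E) (κ : ℝ) (z : S × E) : ℝ≥0∞ :=
  (M.c z.1 z.2 - κ).toENNReal

variable {M : MDP S E} {κ : ℝ}

theorem MDP.measurable_shiftedCost : Measurable (M.shiftedCost κ) :=
  (M.c_meas.sub measurable_const).ereal_toENNReal

section

variable (hκ : ∀ x a, (κ : EReal) ≤ M.c x a)
include hκ

theorem MDP.coe_add_shiftedCost (x : S) (a : E) :
    (κ : EReal) + M.shiftedCost κ (x, a) = M.c x a := by
  have h := hκ x a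
  rw [shiftedCost, EReal.coe_toENNReal]
  · induction hc : M.c x a with
    | bot => simp [hc] at h
    | top => simp
    | coe r => rw [← EReal.coe_sub, ← EReal.coe_add]; simp
  · rwa [EReal.sub_nonneg (Or.inr (EReal.coe_ne_top _)) (Or.inr (EReal.coe_ne_bot _))]

theorem MDP.shiftedCost_le_iff (l : ℝ≥0) (z : S × E) :
    M.shiftedCost κ z ≤ l ↔ M.c z.1 z.2 ≤ ((κ + l : ℝ) : EReal) := by
  rw [← M.coe_add_shiftedCost hκ, EReal.coe_add, ← EReal.coe_nnreal_eq_coe_real,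
    ← EReal.coe_ennreal_le_coe_ennreal_iff]
  exact ((EReal.addLECancellable_coe κ).add_le_add_iff_left).symm

theorem expCost_eq (p : Policy S E) (x : S) (t : ℕ) :
    expCost M p x t = (κ : EReal) + ((∫⁻ z, M.shiftedCost κ z ∂(saMeas M p x t) : ℝ≥0∞) : EReal) := by
  have := eInt_coe_add_coe (integrable_const (μ := saMeas M p x t) κ) (M.measurable_shiftedCost (κ := κ))
  simpa [expCost, M.coe_add_shiftedCost hκ] using this

theorem exists_vDisc_eq {α : ℝ} (hα : α ∈ Ico (0 : ℝ) 1) :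
    ∃ ρ : ℝ, ∀ p x, vDisc M α p x
      = (ρ : EReal) + (discVal M (M.shiftedCost κ) (ENNReal.ofReal α) p x : ℝ≥0∞) := by
  have hint : Integrable (fun t : ℕ => α ^ t * κ) Measure.count := by
    rw [integrable_count_iff]
    exact ((summable_geometric_of_lt_one hα.1 hα.2).mul_right κ).norm
  refine ⟨∫ t : ℕ, α ^ t * κ ∂Measure.count, fun p x => ?_⟩
  rw [discVal, ← lintegral_count, ← eInt_coe_add_coe hint (measurable_of_countable _), vDisc,
    eSum_eq_eInt_count]
  congr with t
  rw [expCost_eq hκ, EReal.coe_mul_coe_add_coe_ennreal (pow_nonneg hα.1 t),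
    ENNReal.ofReal_pow hα.1]

theorem vFin_eq (N : ℕ) (p : Policy S E) (x : S) :
    vFin M N p x = ((N * κ : ℝ) : EReal)
      + ((∑ t ∈ Finset.range N, ∫⁻ z, M.shiftedCost κ z ∂(saMeas M p x t) : ℝ≥0∞) : EReal) := by
  simp only [vFin, expCost_eq hκ]
  induction N with
  | zero => simp
  | succ N ih =>
    rw [Finset.sum_range_succ, ih, Finset.sum_range_succ, EReal.coe_ennreal_add]
    rw [Nat.cast_succ, add_mul, one_mul, EReal.coe_add]
    abel

/-- Discounted optimal values in terms of the shifted cost. -/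
theorem exists_vDiscOpt_eq {α : ℝ} (hα : α ∈ Ico (0 : ℝ) 1) :
    ∃ ρ : ℝ, (∀ x, vDiscOpt M α x
        = (ρ : EReal) + (discOpt M (M.shiftedCost κ) (ENNReal.ofReal α) x : ℝ≥0∞)) ∧
      mDisc M α
        = (ρ : EReal) + ((⨅ x, discOpt M (M.shiftedCost κ) (ENNReal.ofReal α) x : ℝ≥0∞) : EReal) := by
  obtain ⟨ρ, hρ⟩ := exists_vDisc_eq hκ hα
  have h : ∀ x, vDiscOpt M α x
        = (ρ : EReal) + (discOpt M (M.shiftedCost κ) (ENNReal.ofReal α) x : ℝ≥0∞) := fun x => by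
    simp only [vDiscOpt, hρ, EReal.iInf_coe_add_coe_ennreal, discOpt]
  exact ⟨ρ, h, by simp only [mDisc, h, EReal.iInf_coe_add_coe_ennreal]⟩

/-- If the relative value function is not infinite, it is the difference of finite values. -/
theorem uDisc_eq_coe_sub {α : ℝ} (hα : α ∈ Ico (0 : ℝ) 1) {x : S}
    (hbot : uDisc M α x ≠ ⊥) (htop : uDisc M α x ≠ ⊤) :
    discOpt M (M.shiftedCost κ) (ENNReal.ofReal α) x < ⊤ ∧
      uDisc M α x = ((discOpt M (M.shiftedCost κ) (ENNReal.ofReal α) x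
        - ⨅ y, discOpt M (M.shiftedCost κ) (ENNReal.ofReal α) y : ℝ≥0∞) : EReal) := by
  obtain ⟨ρ, hV, hm⟩ := exists_vDiscOpt_eq hκ hα
  rw [uDisc, hV, hm] at hbot htop ⊢
  have hle := iInf_le (fun y => discOpt M (M.shiftedCost κ) (ENNReal.ofReal α) y) x
  generalize discOpt M (M.shiftedCost κ) (ENNReal.ofReal α) x = D at *
  generalize ⨅ y, discOpt M (M.shiftedCost κ) (ENNReal.ofReal α) y = d at *
  have hD : D ≠ ⊤ := by
    rintro rfl
    rcases eq_or_ne d ⊤ with rfl | hd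
    · simp at hbot
    · rw [EReal.coe_ennreal_eq_coe_toReal hd, ← EReal.coe_add, EReal.coe_ennreal_top,
        EReal.coe_add_top] at htop
      exact htop (EReal.top_sub_coe _)
  refine ⟨hD.lt_top, ?_⟩
  have hd : d ≠ ⊤ := (hle.trans_lt hD.lt_top).ne
  rw [EReal.coe_ennreal_eq_coe_toReal hd, EReal.coe_ennreal_eq_coe_toReal hD,
    EReal.coe_ennreal_eq_coe_toReal (ENNReal.sub_ne_top hD), ENNReal.toReal_sub_of_le hle hD,
    ← EReal.coe_add, ← EReal.coe_add, ← EReal.coe_sub]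
  congr 1
  ring

end

end CostShift

section AverageCost

variable {S E : Type*} [MeasurableSpace S] [MeasurableSpace E] {M : MDP S E} {κ : ℝ}
  (hκ : ∀ x a, (κ : EReal) ≤ M.c x a)
include hκ

theorem inv_mul_vFin_eq {N : ℕ} (hN : N ≠ 0) (p : Policy S E) (x : S) :
    (((N : ℝ)⁻¹ : ℝ) : EReal) * vFin M N p x = (κ : EReal) + (((N : ℝ≥0∞)⁻¹
      * ∑ t ∈ Finset.range N, ∫⁻ z, M.shiftedCost κ z ∂(saMeas M p x t) : ℝ≥0∞) : EReal) := by
  have hN' : (0 : ℝ) < N := by positivity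
  rw [vFin_eq hκ, EReal.coe_mul_coe_add_coe_ennreal (inv_nonneg.2 hN'.le),
    inv_mul_cancel_left₀ hN'.ne', ENNReal.ofReal_inv_of_pos hN', ENNReal.ofReal_natCast]

/-- Tauberian lower bound for the average cost of any policy. -/
theorem add_le_avgCost {β m : ℕ → ℝ≥0∞} (hβ : ∀ n, β n < 1) (hβ1 : Tendsto β atTop (𝓝 1))
    (hm : ∀ n x, m n ≤ discOpt M (M.shiftedCost κ) (β n) x) {W : ℝ≥0∞}
    (hW : Tendsto (fun n => (1 - β n) * m n) atTop (𝓝 W)) (p : Policy S E) (x : S) :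
    (κ : EReal) + W ≤ avgCost M p x := by
  by_contra! hlt
  obtain ⟨r, hr, hrW⟩ := EReal.lt_iff_exists_real_btwn.1 hlt
  have hev : ∀ᶠ N : ℕ in atTop, (κ : EReal) + (((N : ℝ≥0∞)⁻¹
      * ∑ t ∈ Finset.range N, ∫⁻ z, M.shiftedCost κ z ∂(saMeas M p x t) : ℝ≥0∞) : EReal) < r := by
    filter_upwards [eventually_lt_of_limsup_lt hr, eventually_ne_atTop 0] with N hN hN0
    rwa [inv_mul_vFin_eq hκ hN0] at hN
  have hκr : κ ≤ r := by
    obtain ⟨N, hN⟩ := hev.exists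
    exact_mod_cast (le_add_of_nonneg_right (EReal.coe_ennreal_nonneg _)).trans hN.le
  have hrs : (r : EReal) = κ + ((ENNReal.ofReal (r - κ) : ℝ≥0∞) : EReal) := by
    rw [EReal.coe_ennreal_ofReal, max_eq_left (sub_nonneg.2 hκr), ← EReal.coe_add]
    simp
  rw [hrs] at hrW hev
  have hsum : ∀ᶠ N : ℕ in atTop,
      ∑ t ∈ Finset.range N, ∫⁻ z, M.shiftedCost κ z ∂(saMeas M p x t)
        ≤ N * ENNReal.ofReal (r - κ) := by
    filter_upwards [hev, eventually_ne_atTop 0] with N hN hN0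
    have := EReal.coe_add_coe_ennreal_le_iff.1 hN.le
    rwa [mul_comm, ← div_eq_mul_inv, ENNReal.div_le_iff (by simpa using hN0) (by simp),
      mul_comm] at this
  obtain ⟨C, hC, hbound⟩ := exists_one_sub_mul_tsum_le ENNReal.ofReal_ne_top hsum
  have hlim : Tendsto (fun n => (1 - β n) * C + ENNReal.ofReal (r - κ)) atTop
      (𝓝 ((1 - 1) * C + ENNReal.ofReal (r - κ))) :=
    (ENNReal.Tendsto.mul_const (ENNReal.Tendsto.sub tendsto_const_nhds hβ1 (by simp))
      (Or.inr hC)).add tendsto_const_nhds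
  rw [tsub_self, zero_mul, zero_add] at hlim
  have hWle : W ≤ ENNReal.ofReal (r - κ) := le_of_tendsto_of_tendsto' hW hlim fun n =>
    (mul_le_mul_right ((hm n x).trans (iInf_le _ p)) _).trans (hbound (β n) (hβ n))
  exact hrW.not_ge (EReal.coe_add_coe_ennreal_le_iff.2 hWle)

theorem avgCost_detPolicy_le {φ : S → E} (hφ : Measurable φ) {u : S → ℝ≥0∞} (hu : Measurable u)
    {W : ℝ≥0∞} (h : ∀ x, actionVal M (M.shiftedCost κ) 1 u (x, φ x) ≤ W + u x)
    {x : S} (hux : u x ≠ ⊤) : avgCost M (detPolicy φ hφ) x ≤ κ + W := by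
  have hlim : Tendsto (fun N : ℕ => W + (N : ℝ≥0∞)⁻¹ * u x) atTop (𝓝 (W + 0 * u x)) :=
    tendsto_const_nhds.add
      (ENNReal.Tendsto.mul_const ENNReal.tendsto_inv_nat_nhds_zero (Or.inr hux))
  rw [zero_mul, add_zero] at hlim
  have hlim' := ((EReal.continuous_coe_add_coe_ennreal κ).tendsto W).comp hlim
  rw [← hlim'.limsup_eq]
  refine limsup_le_limsup ?_
  filter_upwards [eventually_ne_atTop 0] with N hN
  rw [inv_mul_vFin_eq hκ hN]
  refine EReal.coe_add_coe_ennreal_le_iff.2 ?_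
  calc (N : ℝ≥0∞)⁻¹ * _ ≤ (N : ℝ≥0∞)⁻¹ * (N * W + u x) := by
        gcongr
        exact le_self_add.trans (sum_le_of_average_inequality M.measurable_shiftedCost hφ hu h x N)
    _ = _ := by
        rw [mul_add, ← mul_assoc, ENNReal.inv_mul_cancel (by simpa using hN) (by simp), one_mul]

end AverageCost

section InfCompactness

variable {S E : Type*} [MetricSpace S] [MeasurableSpace S] [MetricSpace E] [MeasurableSpace E]
  {M : MDP S E} {κ : ℝ}

theorem AssumptionWi.isCompact_shiftedCost_le (hM : AssumptionWi M)
    (hκ : ∀ x a, (κ : EReal) ≤ M.c x a) {xs : ℕ → S} {x : S} (hx : Tendsto xs atTop (𝓝 x))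
    (l : ℝ≥0) : IsCompact {z : S × E | z.1 ∈ insert x (range xs) ∧ M.shiftedCost κ z ≤ l} := by
  simp only [MDP.shiftedCost_le_iff hκ]
  exact hM _ (insert_nonempty _ _) hx.isCompact_insert_range _

theorem AssumptionWi.lowerSemicontinuous_shiftedCost (hM : AssumptionWi M)
    (hκ : ∀ x a, (κ : EReal) ≤ M.c x a) : LowerSemicontinuous (M.shiftedCost κ) := by
  rw [lowerSemicontinuous_iff_isClosed_preimage]
  intro l
  induction l using ENNReal.recTopCoe with
  | top => simp
  | coe l =>
    refine IsSeqClosed.isClosed fun zs z hzs hz => ?_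
    have hfst : Tendsto (fun n => (zs n).1) atTop (𝓝 z.1) := (continuous_fst.tendsto z).comp hz
    exact ((hM.isCompact_shiftedCost_le hκ hfst l).isClosed.mem_of_tendsto hz
      (Eventually.of_forall fun n => ⟨mem_insert_of_mem _ ⟨n, rfl⟩, hzs n⟩)).2

theorem AssumptionWi.seqInfCompact_shiftedCost (hM : AssumptionWi M)
    (hκ : ∀ x a, (κ : EReal) ≤ M.c x a) : SeqInfCompact (M.shiftedCost κ) := by
  intro xs x bs l hx hl hb
  lift l to ℝ≥0 using hl.ne
  obtain ⟨z, -, ψ, hψ, hz⟩ := (hM.isCompact_shiftedCost_le hκ hx l).tendsto_subseq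
    (x := fun n => (xs n, bs n)) fun n => ⟨mem_insert_of_mem _ ⟨n, rfl⟩, hb n⟩
  exact ⟨z.2, ψ, hψ, (continuous_snd.tendsto z).comp hz⟩

end InfCompactness

/-- Infima of a lower semi-equicontinuous family are lower semicontinuous. -/
theorem lowerSemicontinuous_biInf_of_equi {ι S : Type*} [PseudoMetricSpace S]
    {U : ι → S → ℝ≥0∞} (hU : ∀ x, ∀ ε : ℝ, 0 < ε → ∃ δ > (0 : ℝ), ∀ y, dist y x < δ →
      ∀ i, (U i x : EReal) - (ε : EReal) < U i y) (s : Set ι) :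
    LowerSemicontinuous fun x => ⨅ i ∈ s, U i x := by
  intro x t ht
  obtain ⟨t₂, ht₂, ht₂'⟩ := exists_between ht
  obtain ⟨t₁, ht₁, ht₁'⟩ := exists_between ht₂
  lift t₂ to ℝ≥0 using (ht₂'.trans_le le_top).ne
  lift t₁ to ℝ≥0 using (ht₁'.trans_le le_top).ne
  have hε : (0 : ℝ) < t₂ - t₁ := sub_pos.2 (by exact_mod_cast ht₁')
  obtain ⟨δ, hδ, h⟩ := hU x _ hε
  filter_upwards [Metric.ball_mem_nhds x hδ] with y hy
  refine ht₁.trans_le (le_iInf₂ fun i hi => ?_)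
  have hle : ((t₂ : ℝ≥0∞) : EReal) ≤ U i x :=
    EReal.coe_ennreal_le_coe_ennreal_iff.2 (ht₂'.le.trans (iInf₂_le i hi))
  have := (EReal.sub_le_sub hle le_rfl).trans (h y hy i).le
  rw [EReal.coe_nnreal_eq_coe_real, ← EReal.coe_sub, sub_sub_cancel,
    ← EReal.coe_nnreal_eq_coe_real] at this
  exact EReal.coe_ennreal_le_coe_ennreal_iff.1 this

section Statements

variable {X A : Type*} [MetricSpace X] [TopologicalSpace.SeparableSpace X]
  [MeasurableSpace X] [BorelSpace X] [StandardBorelSpace X]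
  [MetricSpace A] [TopologicalSpace.SeparableSpace A]
  [MeasurableSpace A] [BorelSpace A] [StandardBorelSpace A]

/-- Theorem 3.9. Under Assumptions W*, B̲_{{α_n}}, and LEC_{{α_n}},
there is a deterministic policy `φ` such that the ACOE holds with
`u(x) := lim_{n→∞} u_{α_n}(x)`: for all `x`,
`w* + u(x) = c(x,φ(x)) + ∫ u dq(·|x,φ(x)) = min_{a∈A} [c(x,a) + ∫ u dq(·|x,a)]`. -/
theorem statement5
    (M : MDP X A)
    (hW1 : AssumptionWi M) (hW2 : AssumptionWii M)
    (a : ℕ → ℝ)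
    (ha : ∀ n, a n ∈ Set.Ico (0 : ℝ) 1) (hamono : Monotone a)
    (hatend : Tendsto a atTop (𝓝 (1 : ℝ)))
    (hB1 : wStar M < ⊤)
    (hB2 : ∀ x, Filter.liminf (fun n => uDisc M (a n) x) atTop < ⊤)
    (hLEC1 : ∀ x : X, ∀ ε : ℝ, 0 < ε → ∃ δ > (0 : ℝ), ∀ y : X, dist y x < δ →
      ∀ n : ℕ, uDisc M (a n) x - (ε : EReal) < uDisc M (a n) y)
    (hLEC2 : ∀ x : X, ∃ L : ℝ,
      Tendsto (fun n : ℕ => uDisc M (a n) x) atTop (𝓝 (L : EReal)))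
    (hLEC3 : ∀ x : X, ∀ b : A,
      Tendsto (fun K : ℝ => Filter.limsup (fun n : ℕ =>
          ∫⁻ y in {y : X | (K : EReal) ≤ uDisc M (a n) y},
            eToENN (uDisc M (a n) y) ∂ (M.q (x, b))) atTop)
        atTop (𝓝 (0 : ℝ≥0∞))) :
    ∃ (φ : X → A) (_ : Measurable φ), ∀ x : X,
      wStar M + uPointwise M a x
        = M.c x (φ x) + eInt (M.q (x, φ x)) (uPointwise M a)
      ∧ M.c x (φ x) + eInt (M.q (x, φ x)) (uPointwise M a)
        = ⨅ b : A, (M.c x b + eInt (M.q (x, b)) (uPointwise M a)) := by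
  rcases isEmpty_or_nonempty X with hX | hX
  · exact ⟨isEmptyElim, measurable_of_empty _, isEmptyElim⟩
  have : SecondCountableTopology A := UniformSpace.secondCountable_of_separable A
  obtain ⟨κ, hκ⟩ := M.c_ne_bot
  set β : ℕ → ℝ≥0∞ := fun n => ENNReal.ofReal (a n) with hβdef
  set V : ℕ → X → ℝ≥0∞ := fun n => discOpt M (M.shiftedCost κ) (β n) with hV
  set m : ℕ → ℝ≥0∞ := fun n => ⨅ y, V n y with hmdef
  have hself : ∀ n x, uDisc M (a n) x - ((1 : ℝ) : EReal) < uDisc M (a n) x := fun n x => by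
    obtain ⟨δ, hδ, h⟩ := hLEC1 x 1 one_pos
    exact h x (by simpa using hδ) n
  have hdisc : ∀ n x, V n x < ⊤ ∧ uDisc M (a n) x = ((V n x - m n : ℝ≥0∞) : EReal) := fun n x =>
    uDisc_eq_coe_sub hκ (ha n) (fun h => not_lt_bot (h ▸ hself n x)) fun h => by
      have := hself n x
      rw [h, EReal.top_sub_coe] at this
      exact lt_irrefl _ this
  have hu_eq : ∀ n x, uDisc M (a n) x = ((V n x - m n : ℝ≥0∞) : EReal) := fun n x => (hdisc n x).2
  have hmV : ∀ n x, m n ≤ V n x := fun n x => iInf_le _ x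
  have hm : ∀ n, m n ≠ ⊤ := fun n =>
    ((hmV n (Classical.arbitrary X)).trans_lt (hdisc n _).1).ne
  have hβlt : ∀ n, β n < 1 := fun n => ENNReal.ofReal_lt_one.2 (ha n).2
  have hβmono : Monotone β := fun i j h => ENNReal.ofReal_le_ofReal (hamono h)
  have hβtend : Tendsto β atTop (𝓝 1) := by
    simpa using ENNReal.tendsto_ofReal hatend
  choose L hL using hLEC2
  set u : X → ℝ≥0∞ := fun x => ENNReal.ofReal (L x) with hu
  have hlim : ∀ x, Tendsto (fun n => V n x - m n) atTop (𝓝 (u x)) := fun x => by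
    have := (EReal.continuous_toENNReal.tendsto _).comp (hL x)
    simpa [Function.comp_def, hu_eq, EReal.toENNReal_coe] using this
  have hpoint : uPointwise M a = fun x => (u x : EReal) := funext fun x => by
    have := (continuous_coe_ennreal_ereal.tendsto _).comp (hlim x)
    simpa [Function.comp_def, uPointwise, hu_eq] using this.liminf_eq
  obtain ⟨W, -, ψ, hψ, hW⟩ := isCompact_univ.tendsto_subseq
    (x := fun n => (1 - β n) * m n) fun n => mem_univ _
  have hψt := hψ.tendsto_atTop
  have hWle : (κ : EReal) + W ≤ wStar M := le_iInf fun x => le_iInf fun p =>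
    add_le_avgCost hκ (fun n => hβlt (ψ n)) (hβtend.comp hψt) (fun n => hmV (ψ n)) hW p x
  have hWtop : W < ⊤ := by
    refine lt_top_iff_ne_top.2 fun h => ?_
    rw [h, EReal.coe_ennreal_top, EReal.coe_add_top] at hWle
    exact hB1.not_ge hWle
  have hequi : ∀ x, ∀ ε : ℝ, 0 < ε → ∃ δ > (0 : ℝ), ∀ y, dist y x < δ → ∀ n,
      ((V (ψ n) x - m (ψ n) : ℝ≥0∞) : EReal) - (ε : EReal) < (V (ψ n) y - m (ψ n) : ℝ≥0∞) := by
    intro x ε hε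
    obtain ⟨δ, hδ, h⟩ := hLEC1 x ε hε
    exact ⟨δ, hδ, fun y hy n => by simpa only [hu_eq] using h y hy (ψ n)⟩
  have hui : ∀ z : X × A, Tendsto (fun K : ℝ => limsup (fun n =>
      ∫⁻ y in {y | ENNReal.ofReal K ≤ V (ψ n) y - m (ψ n)}, (V (ψ n) y - m (ψ n)) ∂(M.q z)) atTop)
      atTop (𝓝 0) := by
    intro z
    have h := hLEC3 z.1 z.2
    simp only [hu_eq, eToENN_coe_ennreal, EReal.coe_le_coe_ennreal_iff] at h
    refine tendsto_of_tendsto_of_tendsto_of_le_of_le tendsto_const_nhds h (fun _ => bot_le)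
      fun K => ?_
    exact (limsup_comp (fun n => ∫⁻ y in {y | ENNReal.ofReal K ≤ V n y - m n},
      (V n y - m n) ∂(M.q z)) ψ atTop).trans_le (limsup_le_limsup_of_le hψt)
  have hg := hW1.lowerSemicontinuous_shiftedCost hκ
  obtain ⟨hum, ⟨φ, hφ, hφu⟩, hlow⟩ := exists_selector_of_vanishing_discount hW2 hg
    (hW1.seqInfCompact_shiftedCost hκ) (fun n => (hβlt (ψ n)).le) (hβmono.comp hψ.monotone)
    (hβtend.comp hψt) (fun n x => (hdisc (ψ n) x).1) (fun n => hm (ψ n)) (fun n => hmV (ψ n))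
    (fun N => lowerSemicontinuous_biInf_of_equi hequi {k | N ≤ k})
    (fun x => ENNReal.ofReal_lt_top) (fun x => (hlim x).comp hψt) hui hWtop hW
  have hw : wStar M = (κ : EReal) + W := by
    refine le_antisymm ?_ hWle
    exact (iInf_le _ (Classical.arbitrary X)).trans ((iInf_le _ (detPolicy φ hφ)).trans
      (avgCost_detPolicy_le hκ hφ hum hφu ENNReal.ofReal_ne_top))
  have hval : ∀ z : X × A, M.c z.1 z.2 + eInt (M.q z) (uPointwise M a)
      = (κ : EReal) + (actionVal M (M.shiftedCost κ) 1 u z : ℝ≥0∞) := fun z => by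
    rw [hpoint, eInt_coe_ennreal _ hum, ← M.coe_add_shiftedCost hκ, actionVal, one_mul,
      EReal.coe_ennreal_add, add_assoc]
  have hACOE : ∀ x, wStar M + uPointwise M a x = (κ : EReal) + ((W + u x : ℝ≥0∞) : EReal) :=
    fun x => by rw [hw, hpoint, EReal.coe_ennreal_add, add_assoc]
  have hmin : ∀ x b, wStar M + uPointwise M a x
      ≤ M.c x b + eInt (M.q (x, b)) (uPointwise M a) := fun x b => by
    rw [hACOE, hval (x, b)]
    exact EReal.coe_add_coe_ennreal_le_iff.2 (hlow (x, b))
  have heq : ∀ x, wStar M + uPointwise M a x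
      = M.c x (φ x) + eInt (M.q (x, φ x)) (uPointwise M a) := fun x => by
    refine le_antisymm (hmin x (φ x)) ?_
    rw [hACOE, hval (x, φ x)]
    exact EReal.coe_add_coe_ennreal_le_iff.2 (hφu x)
  exact ⟨φ, hφ, fun x => ⟨heq x, le_antisymm (le_iInf fun b => (heq x).symm.trans_le (hmin x b))
    (iInf_le _ (φ x))⟩⟩

end Statements

end
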